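/- Fix γ_l, γ_r > 2 and let B(a,b) = Γ(a)Γ(b)/Γ(a+b) denote the Beta function. Let K be a compact subset of the open region {(π_l, π_r, k_l, k_r) ∈ ℝ⁴ : 0 < π_l, 0 < π_r, π_l + π_r < 1, 0 < k_l < 1, 0 < k_r < 1}, and for p ∈ K let b_p be the associated reciprocal assessor on (0,1). For p ∈ K and m ∈ (0,1), let J_p(m) denote the unique open sublevel interval of b_p with Lebesgue measure m. Then for every t̲ > 0 and ε > 0 there exists δ > 0 such that for all p, p* ∈ K with coordinate-wise distance ‖p − p*‖_∞ < δ and every t ≥ t̲, writing m* for the Lebesgue measure of the set I = {u ∈ (0,1) : b_{p*}(u) < 1/t}: (a) if m* > ε then J_{p*}(m* − ε) ⊆ {u ∈ (0,1) : b_p(u) < 1/t}, and (b) if m* + ε < 1 then {u ∈ (0,1) : b_p(u) < 1/t} ⊆ J_{p*}(m* + ε). -/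

import Mathlib

open Set Filter MeasureTheory

/-- The Beta function `B(a,b) = Γ(a)Γ(b)/Γ(a+b)`. -/
noncomputable def betaFn (a b : ℝ) : ℝ := Real.Gamma a * Real.Gamma b / Real.Gamma (a + b)

/-- The open parameter region `{(π_l, π_r, k_l, k_r) : 0 < π_l, 0 < π_r, π_l + π_r < 1,
0 < k_l < 1, 0 < k_r < 1}`. -/
def paramRegion : Set (ℝ × ℝ × ℝ × ℝ) :=
  {p | 0 < p.1 ∧ 0 < p.2.1 ∧ p.1 + p.2.1 < 1 ∧
    0 < p.2.2.1 ∧ p.2.2.1 < 1 ∧ 0 < p.2.2.2 ∧ p.2.2.2 < 1}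

/-- The reciprocal assessor `b_p(u)` of the working beta-mixture model with parameters
`p = (π_l, π_r, k_l, k_r)` and fixed shape parameters `γ_l, γ_r`. -/
noncomputable def bAssessor (γl γr : ℝ) (p : ℝ × ℝ × ℝ × ℝ) (u : ℝ) : ℝ :=
  1 + (p.1 * (betaFn p.2.2.1 γl)⁻¹ * u ^ (p.2.2.1 - 1) * (1 - u) ^ (γl - 1)
    + p.2.1 * (betaFn γr p.2.2.2)⁻¹ * u ^ (γr - 1) * (1 - u) ^ (p.2.2.2 - 1))
    / (1 - p.1 - p.2.1)

open Topology

lemma isOpen_paramRegion : IsOpen paramRegion := by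
  have h : ∀ {f g : ℝ × ℝ × ℝ × ℝ → ℝ}, Continuous f → Continuous g → IsOpen {p | f p < g p} :=
    fun hf hg => isOpen_lt hf hg
  refine (h ?_ ?_).inter ((h ?_ ?_).inter ((h ?_ ?_).inter ((h ?_ ?_).inter ((h ?_ ?_).inter
    ((h ?_ ?_).inter (h ?_ ?_)))))) <;> fun_prop

lemma betaFn_pos {a b : ℝ} (ha : 0 < a) (hb : 0 < b) : 0 < betaFn a b :=
  div_pos (mul_pos (Real.Gamma_pos_of_pos ha) (Real.Gamma_pos_of_pos hb))
    (Real.Gamma_pos_of_pos (add_pos ha hb))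

lemma Real.continuousAt_Gamma_of_pos {a : ℝ} (ha : 0 < a) : ContinuousAt Real.Gamma a :=
  (Real.differentiableAt_Gamma fun m => by
    have : (0 : ℝ) ≤ m := m.cast_nonneg
    linarith).continuousAt

lemma Filter.Tendsto.betaFn {α : Type*} {l : Filter α} {f g : α → ℝ} {a b : ℝ}
    (hf : Tendsto f l (𝓝 a)) (hg : Tendsto g l (𝓝 b)) (ha : 0 < a) (hb : 0 < b) :
    Tendsto (fun x => betaFn (f x) (g x)) l (𝓝 (betaFn a b)) :=
  (((Real.continuousAt_Gamma_of_pos ha).tendsto.comp hf).mul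
    ((Real.continuousAt_Gamma_of_pos hb).tendsto.comp hg)).div
    ((Real.continuousAt_Gamma_of_pos (add_pos ha hb)).tendsto.comp (hf.add hg))
    (Real.Gamma_pos_of_pos (add_pos ha hb)).ne'

section Assessor

variable {γl γr : ℝ}

lemma continuousAt_bAssessor (hγl : 0 < γl) (hγr : 0 < γr) {p : ℝ × ℝ × ℝ × ℝ}
    (hp : p ∈ paramRegion) {u : ℝ} (hu : u ∈ Ioo (0 : ℝ) 1) :
    ContinuousAt (fun z : (ℝ × ℝ × ℝ × ℝ) × ℝ => bAssessor γl γr z.1 z.2) (p, u) := by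
  obtain ⟨-, -, hD, hkl, -, hkr, -⟩ := hp
  have hBl : ContinuousAt (fun z : (ℝ × ℝ × ℝ × ℝ) × ℝ => betaFn z.1.2.2.1 γl) (p, u) :=
    Filter.Tendsto.betaFn (Continuous.tendsto (by fun_prop) _) tendsto_const_nhds hkl hγl
  have hBr : ContinuousAt (fun z : (ℝ × ℝ × ℝ × ℝ) × ℝ => betaFn γr z.1.2.2.2) (p, u) :=
    Filter.Tendsto.betaFn tendsto_const_nhds (Continuous.tendsto (by fun_prop) _) hγr hkr
  have hBl' := hBl.inv₀ (betaFn_pos hkl hγl).ne'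
  have hBr' := hBr.inv₀ (betaFn_pos hγr hkr).ne'
  have hu0 : u ≠ 0 := hu.1.ne'
  have hu1 : 1 - u ≠ 0 := (sub_pos.2 hu.2).ne'
  have h1 : ContinuousAt (fun z : (ℝ × ℝ × ℝ × ℝ) × ℝ => z.2 ^ (z.1.2.2.1 - 1)) (p, u) :=
    ContinuousAt.rpow (by fun_prop) (by fun_prop) (Or.inl hu0)
  have h2 : ContinuousAt (fun z : (ℝ × ℝ × ℝ × ℝ) × ℝ => (1 - z.2) ^ (γl - 1)) (p, u) :=
    ContinuousAt.rpow (by fun_prop) (by fun_prop) (Or.inl hu1)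
  have h3 : ContinuousAt (fun z : (ℝ × ℝ × ℝ × ℝ) × ℝ => z.2 ^ (γr - 1)) (p, u) :=
    ContinuousAt.rpow (by fun_prop) (by fun_prop) (Or.inl hu0)
  have h4 : ContinuousAt (fun z : (ℝ × ℝ × ℝ × ℝ) × ℝ => (1 - z.2) ^ (z.1.2.2.2 - 1)) (p, u) :=
    ContinuousAt.rpow (by fun_prop) (by fun_prop) (Or.inl hu1)
  unfold bAssessor
  refine continuousAt_const.add (ContinuousAt.div ?_ (by fun_prop) ?_)
  · exact (((ContinuousAt.mul (by fun_prop) hBl').mul h1).mul h2).add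
      (((ContinuousAt.mul (by fun_prop) hBr').mul h3).mul h4)
  · exact (by linarith : (0 : ℝ) < 1 - p.1 - p.2.1).ne'

lemma measurable_bAssessor (p : ℝ × ℝ × ℝ × ℝ) : Measurable (bAssessor γl γr p) := by
  unfold bAssessor
  fun_prop

/-- Exchanging the two mixture components amounts to reflecting the unit interval. -/
lemma bAssessor_reflect (p : ℝ × ℝ × ℝ × ℝ) (u : ℝ) :
    bAssessor γl γr p u = bAssessor γr γl (p.2.1, p.1, p.2.2.2, p.2.2.1) (1 - u) := by
  simp only [bAssessor, betaFn, sub_sub_cancel]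
  rw [mul_comm (Real.Gamma p.2.2.1), mul_comm (Real.Gamma γr), add_comm γr, add_comm p.2.2.1]
  ring

lemma le_bAssessor (hγl : 0 < γl) (hγr : 0 < γr) {p : ℝ × ℝ × ℝ × ℝ}
    (hp : p ∈ paramRegion) {u : ℝ} (hu : u ∈ Ioo (0 : ℝ) 1) :
    p.1 * (betaFn p.2.2.1 γl)⁻¹ * u ^ (p.2.2.1 - 1) * (1 - u) ^ (γl - 1)
      ≤ bAssessor γl γr p u := by
  obtain ⟨hl, hr, hD, hkl, -, hkr, -⟩ := hp
  have hu0 : 0 < u := hu.1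
  have hu1 : 0 < 1 - u := sub_pos.2 hu.2
  have hBl := betaFn_pos hkl hγl
  have hBr := betaFn_pos hγr hkr
  have h1 : 0 < p.1 * (betaFn p.2.2.1 γl)⁻¹ * u ^ (p.2.2.1 - 1) * (1 - u) ^ (γl - 1) := by
    positivity
  have h2 : 0 < p.2.1 * (betaFn γr p.2.2.2)⁻¹ * u ^ (γr - 1) * (1 - u) ^ (p.2.2.2 - 1) := by
    positivity
  unfold bAssessor
  have h3 := le_div_self (add_pos h1 h2).le (by linarith : 0 < 1 - p.1 - p.2.1) (by linarith)
  linarith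

lemma tendsto_bAssessor_nhdsGT_zero (hγl : 0 < γl) (hγr : 0 < γr) {p : ℝ × ℝ × ℝ × ℝ}
    (hp : p ∈ paramRegion) :
    Tendsto (fun z : ℝ × (ℝ × ℝ × ℝ × ℝ) => bAssessor γl γr z.2 z.1) (𝓝[>] 0 ×ˢ 𝓝 p) atTop := by
  have hmem : ∀ᶠ z : ℝ × (ℝ × ℝ × ℝ × ℝ) in 𝓝[>] 0 ×ˢ 𝓝 p,
      z.1 ∈ Ioo (0 : ℝ) 1 ∧ z.2 ∈ paramRegion :=
    prod_mem_prod (Ioo_mem_nhdsGT one_pos) (isOpen_paramRegion.mem_nhds hp)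
  refine tendsto_atTop_mono' _ (hmem.mono fun z hz => le_bAssessor hγl hγr hz.2 hz.1) ?_
  obtain ⟨hl, -, -, hkl, hkl1, -, -⟩ := hp
  have hfst : Tendsto (fun z : ℝ × (ℝ × ℝ × ℝ × ℝ) => z.1) (𝓝[>] 0 ×ˢ 𝓝 p) (𝓝[>] 0) :=
    tendsto_fst
  have hfst' := hfst.mono_right nhdsWithin_le_nhds
  have hsnd : Tendsto (fun z : ℝ × (ℝ × ℝ × ℝ × ℝ) => z.2) (𝓝[>] 0 ×ˢ 𝓝 p) (𝓝 p) :=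
    tendsto_snd
  have hk : Tendsto (fun z : ℝ × (ℝ × ℝ × ℝ × ℝ) => z.2.2.2.1) (𝓝[>] 0 ×ˢ 𝓝 p)
      (𝓝 p.2.2.1) := hsnd.snd_nhds.snd_nhds.fst_nhds
  have hcoef := hsnd.fst_nhds.mul
    ((hk.betaFn (tendsto_const_nhds (x := γl)) hkl hγl).inv₀ (betaFn_pos hkl hγl).ne')
  have hpow : Tendsto (fun z : ℝ × (ℝ × ℝ × ℝ × ℝ) => z.1 ^ (z.2.2.2.1 - 1))
      (𝓝[>] 0 ×ˢ 𝓝 p) atTop := by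
    refine (Real.tendsto_exp_atTop.comp ((Real.tendsto_log_nhdsGT_zero.comp hfst).atBot_mul_neg
      (sub_neg.2 hkl1) (hk.sub_const 1))).congr' (hmem.mono fun z hz => ?_)
    exact (Real.rpow_def_of_pos hz.1.1 _).symm
  have hone : Tendsto (fun z : ℝ × (ℝ × ℝ × ℝ × ℝ) => (1 - z.1) ^ (γl - 1))
      (𝓝[>] 0 ×ˢ 𝓝 p) (𝓝 1) := by
    simpa using (hfst'.const_sub 1).rpow_const (p := γl - 1) (Or.inl (by norm_num))
  exact (hcoef.pos_mul_atTop (mul_pos hl (inv_pos.2 (betaFn_pos hkl hγl))) hpow).atTop_mul_pos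
    one_pos hone

/-- Near the left endpoint, the assessors with parameters in a compact set are uniformly large. -/
lemma eventually_lt_bAssessor (hγl : 0 < γl) (hγr : 0 < γr) {K : Set (ℝ × ℝ × ℝ × ℝ)}
    (hK : IsCompact K) (hKsub : K ⊆ paramRegion) (y : ℝ) :
    ∀ᶠ u in 𝓝[>] (0 : ℝ), ∀ p ∈ K, y < bAssessor γl γr p u := by
  simp only [eventually_nhdsWithin_iff]
  suffices ∀ᶠ u in 𝓝 (0 : ℝ), ∀ p ∈ K, u ∈ Ioi 0 → y < bAssessor γl γr p u from
    this.mono fun u h hu p hp => h p hp hu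
  refine hK.eventually_forall_of_forall_eventually fun p hp => ?_
  have h := (tendsto_bAssessor_nhdsGT_zero hγl hγr (hKsub hp)).eventually_gt_atTop y
  rw [← nhdsWithin_univ p, ← nhdsWithin_prod_eq, eventually_nhdsWithin_iff] at h
  exact h.mono fun z hz hz' => hz ⟨hz', mem_univ _⟩

lemma exists_forall_mem_Icc_of_bAssessor_le (hγl : 0 < γl) (hγr : 0 < γr)
    {K : Set (ℝ × ℝ × ℝ × ℝ)} (hK : IsCompact K) (hKsub : K ⊆ paramRegion) (y : ℝ) :
    ∃ a > 0, ∀ p ∈ K, ∀ u ∈ Ioo (0 : ℝ) 1, bAssessor γl γr p u ≤ y → u ∈ Icc a (1 - a) := by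
  let s : ℝ × ℝ × ℝ × ℝ → ℝ × ℝ × ℝ × ℝ := fun p => (p.2.1, p.1, p.2.2.2, p.2.2.1)
  have hs : s '' K ⊆ paramRegion := by
    rintro _ ⟨p, hp, rfl⟩
    obtain ⟨h1, h2, h3, h4, h5, h6, h7⟩ := hKsub hp
    exact ⟨h2, h1, by rwa [add_comm], h6, h7, h4, h5⟩
  have h := (eventually_lt_bAssessor hγl hγr hK hKsub y).and
    (eventually_lt_bAssessor hγr hγl (hK.image (by fun_prop : Continuous s)) hs y)
  obtain ⟨a, ha, hlt⟩ := mem_nhdsGT_iff_exists_Ioo_subset.1 h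
  refine ⟨a, ha, fun p hp u hu hle => ⟨?_, ?_⟩⟩
  · by_contra! hua
    exact (((hlt ⟨hu.1, hua⟩).1 p hp).trans_le hle).false
  · by_contra! hua
    have := (hlt ⟨sub_pos.2 hu.2, by linarith⟩).2 (s p) (mem_image_of_mem s hp)
    rw [← bAssessor_reflect] at this
    exact (this.trans_le hle).false

end Assessor

lemma strictConvexOn_rpow_of_neg {q : ℝ} (hq : q < 0) :
    StrictConvexOn ℝ (Ioi 0) fun x : ℝ => x ^ q := by
  refine ⟨convex_Ioi 0, fun x hx y hy hxy a b ha hb hab => ?_⟩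
  have hmid := convex_Ioi (0 : ℝ) hx hy ha.le hb.le hab
  have hlog := strictConcaveOn_log_Ioi.2 hx hy hxy ha hb hab
  have hexp := convexOn_exp.2 (mem_univ (Real.log x * q)) (mem_univ (Real.log y * q))
    ha.le hb.le hab
  simp only [smul_eq_mul, mem_Ioi] at *
  rw [Real.rpow_def_of_pos hx, Real.rpow_def_of_pos hy, Real.rpow_def_of_pos hmid]
  refine (Real.exp_lt_exp.2 ?_).trans_le hexp
  nlinarith

lemma StrictConvexOn.mul_convexOn_of_monovaryOn {s : Set ℝ} {f g : ℝ → ℝ}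
    (hf : StrictConvexOn ℝ s f) (hg : ConvexOn ℝ s g) (hf₀ : ∀ x ∈ s, 0 ≤ f x)
    (hg₀ : ∀ x ∈ s, 0 < g x) (hfg : MonovaryOn f g s) :
    StrictConvexOn ℝ s fun x => f x * g x := by
  refine ⟨hf.1, fun x hx y hy hxy a b ha hb hab => ?_⟩
  have hm := hf.1 hx hy ha.le hb.le hab
  have h1 := hf.2 hx hy hxy ha hb hab
  have h2 := hg.2 hx hy ha.le hb.le hab
  have h3 := hfg.sub_mul_sub_nonneg hx hy
  have h4 := hg₀ _ hm
  have h5 := hf₀ x hx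
  have h6 := hf₀ y hy
  simp only [smul_eq_mul] at *
  calc _ < (a * f x + b * f y) * g (a * x + b * y) := mul_lt_mul_of_pos_right h1 h4
    _ ≤ (a * f x + b * f y) * (a * g x + b * g y) := by gcongr
    _ = a * (f x * g x) + b * (f y * g y) - a * b * ((f y - f x) * (g y - g x)) := by
      obtain rfl : b = 1 - a := by linarith
      ring
    _ ≤ _ := sub_le_self _ (by positivity)

lemma strictConvexOn_rpow_mul_one_sub_rpow {q r : ℝ} (hq : q < 0) (hr : 1 ≤ r) :
    StrictConvexOn ℝ (Ioo 0 1) fun u : ℝ => u ^ q * (1 - u) ^ r := by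
  have hsub : Ioo (0 : ℝ) 1 ⊆ Ioi 0 := fun u hu => hu.1
  refine ((strictConvexOn_rpow_of_neg hq).subset hsub
    (convex_Ioo 0 1)).mul_convexOn_of_monovaryOn ?_ (fun u hu => (Real.rpow_pos_of_pos hu.1 _).le)
    (fun u hu => Real.rpow_pos_of_pos (sub_pos.2 hu.2) _) ?_
  · refine ⟨convex_Ioo 0 1, fun x hx y hy a b ha hb hab => ?_⟩
    have h := (convexOn_rpow hr).2 (mem_Ici.2 (sub_pos.2 hx.2).le)
      (mem_Ici.2 (sub_pos.2 hy.2).le) ha hb hab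
    convert h using 2
    simp only [smul_eq_mul]
    linear_combination -hab
  · refine AntitoneOn.monovaryOn (fun x hx y hy hxy => ?_) (fun x hx y hy hxy => ?_)
    · exact Real.rpow_le_rpow_of_nonpos hx.1 hxy hq.le
    · exact Real.rpow_le_rpow (sub_pos.2 hy.2).le (by linarith) (by linarith)

lemma StrictConvexOn.const_mul_of_pos {s : Set ℝ} {f : ℝ → ℝ} (hf : StrictConvexOn ℝ s f)
    {c : ℝ} (hc : 0 < c) : StrictConvexOn ℝ s fun x => c * f x := by
  refine ⟨hf.1, fun x hx y hy hxy a b ha hb hab => ?_⟩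
  have := mul_lt_mul_of_pos_left (hf.2 hx hy hxy ha hb hab) hc
  simp only [smul_eq_mul] at *
  linarith

lemma StrictConvexOn.volume_eq_level {s : Set ℝ} {f : ℝ → ℝ} (hf : StrictConvexOn ℝ s f) (y : ℝ) :
    volume {x | x ∈ s ∧ f x = y} = 0 := by
  refine measure_mono_null (fun x hx => ?_) ((hf.convexOn.convex_le y).addHaar_frontier volume)
  refine ⟨subset_closure ⟨hx.1, hx.2.le⟩, fun hint => ?_⟩
  obtain ⟨r, hr, hball⟩ := Metric.isOpen_iff.1 isOpen_interior x hint
  have hmem : ∀ z, |z - x| < r → z ∈ s ∧ f z ≤ y := fun z hz =>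
    interior_subset (s := {x | x ∈ s ∧ f x ≤ y})
      (hball (by rwa [Metric.mem_ball, Real.dist_eq]))
  have hl := hmem (x - r / 2) (by rw [abs_lt]; constructor <;> linarith)
  have hr' := hmem (x + r / 2) (by rw [abs_lt]; constructor <;> linarith)
  have h := hf.2 hl.1 hr'.1 (by linarith) one_half_pos one_half_pos (add_halves 1)
  rw [show (1 / 2 : ℝ) • (x - r / 2) + (1 / 2 : ℝ) • (x + r / 2) = x by
    simp only [smul_eq_mul]; ring, hx.2] at h
  simp only [smul_eq_mul] at h
  linarith [hl.2, hr'.2]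

section Levels

variable {γl γr : ℝ}

lemma strictConvexOn_bAssessor (hγl : 2 ≤ γl) (hγr : 2 ≤ γr) {p : ℝ × ℝ × ℝ × ℝ}
    (hp : p ∈ paramRegion) : StrictConvexOn ℝ (Ioo 0 1) (bAssessor γl γr p) := by
  obtain ⟨hl, hr, hD, hkl, hkl1, hkr, hkr1⟩ := hp
  have hBl := betaFn_pos hkl (by linarith : 0 < γl)
  have hBr := betaFn_pos (by linarith : 0 < γr) hkr
  have hD' : 0 < 1 - p.1 - p.2.1 := by linarith
  have h1 := (strictConvexOn_rpow_mul_one_sub_rpow (sub_neg.2 hkl1)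
    (by linarith : 1 ≤ γl - 1)).const_mul_of_pos
    (by positivity : 0 < p.1 * (betaFn p.2.2.1 γl)⁻¹ / (1 - p.1 - p.2.1))
  have h2 : StrictConvexOn ℝ (Ioo 0 1) fun u : ℝ => u ^ (γr - 1) * (1 - u) ^ (p.2.2.2 - 1) := by
    have h := strictConvexOn_rpow_mul_one_sub_rpow (sub_neg.2 hkr1) (by linarith : 1 ≤ γr - 1)
    refine ⟨convex_Ioo 0 1, fun x hx y hy hxy a b ha hb hab => ?_⟩
    have h' := h.2 (⟨sub_pos.2 hx.2, by linarith [hx.1]⟩ : 1 - x ∈ Ioo (0 : ℝ) 1)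
      (⟨sub_pos.2 hy.2, by linarith [hy.1]⟩ : 1 - y ∈ Ioo (0 : ℝ) 1)
      (fun e => hxy (by linarith)) ha hb hab
    simp only [smul_eq_mul, sub_sub_cancel] at h' ⊢
    rw [show a * (1 - x) + b * (1 - y) = 1 - (a * x + b * y) by linear_combination hab,
      sub_sub_cancel] at h'
    linarith
  have h2' := h2.const_mul_of_pos
    (by positivity : 0 < p.2.1 * (betaFn γr p.2.2.2)⁻¹ / (1 - p.1 - p.2.1))
  refine ((h1.add h2').add_const 1).congr fun u _ => ?_
  simp only [bAssessor, Pi.add_apply]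
  ring

/-- Thin bands around a level of the assessor have uniformly small measure. -/
lemma eventually_volume_band_lt (hγl : 2 ≤ γl) (hγr : 2 ≤ γr) {K : Set (ℝ × ℝ × ℝ × ℝ)}
    (hK : IsCompact K) (hKsub : K ⊆ paramRegion) (Y : ℝ) {ε : ℝ} (hε : 0 < ε) :
    ∀ᶠ η in 𝓝 (0 : ℝ), ∀ p ∈ K, ∀ y ∈ Icc 0 Y,
      volume {u | u ∈ Ioo (0 : ℝ) 1 ∧ |bAssessor γl γr p u - y| ≤ η} < ENNReal.ofReal ε := by
  suffices ∀ᶠ η in 𝓝 (0 : ℝ), ∀ q ∈ K ×ˢ Icc 0 Y,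
      volume {u | u ∈ Ioo (0 : ℝ) 1 ∧ |bAssessor γl γr q.1 u - q.2| ≤ η} < ENNReal.ofReal ε from
    this.mono fun η h p hp y hy => h (p, y) ⟨hp, hy⟩
  refine (hK.prod isCompact_Icc).eventually_forall_of_forall_eventually ?_
  rintro ⟨p, y⟩ ⟨hp, -⟩
  have hp' := hKsub hp
  have key : Tendsto (fun z : ℝ × ((ℝ × ℝ × ℝ × ℝ) × ℝ) =>
      volume {u | u ∈ Ioo (0 : ℝ) 1 ∧ |bAssessor γl γr z.2.1 u - z.2.2| ≤ z.1})
      (𝓝 (0, (p, y))) (𝓝 (volume (∅ : Set ℝ))) := by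
    refine tendsto_measure_of_ae_tendsto_indicator _ MeasurableSet.empty (fun z => ?_)
      (measurableSet_Ioo (a := (0 : ℝ)) (b := 1)) (by simp)
      (Eventually.of_forall fun z u hu => hu.1) ?_
    · exact measurableSet_Ioo.inter (measurableSet_le
        (((measurable_bAssessor _).sub_const _).abs) measurable_const)
    · have hnull := (strictConvexOn_bAssessor hγl hγr hp').volume_eq_level y
      filter_upwards [measure_eq_zero_iff_ae_notMem.1 hnull] with u hu
      by_cases hu01 : u ∈ Ioo (0 : ℝ) 1
      · have hne : bAssessor γl γr p u ≠ y := fun e => hu ⟨hu01, e⟩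
        have hb : Tendsto (fun z : ℝ × ((ℝ × ℝ × ℝ × ℝ) × ℝ) => bAssessor γl γr z.2.1 u)
            (𝓝 (0, (p, y))) (𝓝 (bAssessor γl γr p u)) :=
          (continuousAt_bAssessor (by linarith) (by linarith) hp' hu01).tendsto.comp
            (f := fun z : ℝ × ((ℝ × ℝ × ℝ × ℝ) × ℝ) => (z.2.1, u))
            (Continuous.tendsto (f := fun z : ℝ × ((ℝ × ℝ × ℝ × ℝ) × ℝ) => (z.2.1, u))
              (by fun_prop) (0, (p, y)))
        have hy : Tendsto (fun z : ℝ × ((ℝ × ℝ × ℝ × ℝ) × ℝ) => z.2.2) (𝓝 (0, (p, y)))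
            (𝓝 y) := Continuous.tendsto (by fun_prop) (0, (p, y))
        have hη : Tendsto (fun z : ℝ × ((ℝ × ℝ × ℝ × ℝ) × ℝ) => z.1) (𝓝 (0, (p, y)))
            (𝓝 0) := Continuous.tendsto (by fun_prop) (0, (p, y))
        filter_upwards [hη.eventually_lt (hb.sub hy).abs (abs_pos.2 (sub_ne_zero.2 hne))] with z hz
        simpa using fun _ _ => hz
      · exact Eventually.of_forall fun z => iff_of_false (fun h => hu01 h.1) (notMem_empty u)
  rw [measure_empty] at key
  exact key.eventually_lt_const (ENNReal.ofReal_pos.2 hε)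

/-- Below a fixed level, the assessor is uniformly continuous in its parameters. -/
lemma exists_sublevel_bAssessor_subset (hγl : 0 < γl) (hγr : 0 < γr) {K : Set (ℝ × ℝ × ℝ × ℝ)}
    (hK : IsCompact K) (hKsub : K ⊆ paramRegion) (Y : ℝ) {η : ℝ} (hη : 0 < η) :
    ∃ δ > 0, ∀ p ∈ K, ∀ q ∈ K, ‖p - q‖ < δ → ∀ y ≤ Y, ∀ u ∈ Ioo (0 : ℝ) 1,
      bAssessor γl γr p u < y → bAssessor γl γr q u < y + η := by
  obtain ⟨a, ha, hmem⟩ := exists_forall_mem_Icc_of_bAssessor_le hγl hγr hK hKsub Y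
  have huc : UniformContinuousOn (fun z : (ℝ × ℝ × ℝ × ℝ) × ℝ => bAssessor γl γr z.1 z.2)
      (K ×ˢ Icc a (1 - a)) :=
    (hK.prod isCompact_Icc).uniformContinuousOn_of_continuous fun z hz =>
      (continuousAt_bAssessor hγl hγr (hKsub hz.1)
        ⟨ha.trans_le hz.2.1, by linarith [hz.2.2]⟩).continuousWithinAt
  obtain ⟨δ, hδ, h⟩ := Metric.uniformContinuousOn_iff.1 huc η hη
  refine ⟨δ, hδ, fun p hp q hq hpq y hy u hu hlt => ?_⟩
  have hua := hmem p hp u hu (hlt.le.trans hy)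
  have := h (p, u) ⟨hp, hua⟩ (q, u) ⟨hq, hua⟩ (by
    rw [Prod.dist_eq, dist_self, dist_eq_norm]
    exact max_lt hpq hδ)
  rw [Real.dist_eq, abs_lt] at this
  linarith [this.1]

end Levels

/-- Lemma D.2 (first event inclusion lemma), restated on the u-scale.  Here `J p m` denotes
the unique open sublevel interval of `b_p` with Lebesgue measure `m` (hypothesized through
its characterizing property), and `m*` is the measure of the sublevel set of `b_{p*}` at
level `1/t`.  Under a small perturbation of the parameters, sublevel sets at threshold `t`
are sandwiched between the `p*`-sublevel intervals of measures `m* - ε` and `m* + ε`. -/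
theorem first_event_inclusion (γl γr : ℝ) (hγl : 2 < γl) (hγr : 2 < γr)
    (K : Set (ℝ × ℝ × ℝ × ℝ)) (hK : IsCompact K) (hKsub : K ⊆ paramRegion)
    (J : (ℝ × ℝ × ℝ × ℝ) → ℝ → Set ℝ)
    (hJ : ∀ p ∈ K, ∀ m ∈ Set.Ioo (0 : ℝ) 1,
      (∃ y : ℝ, J p m = {u : ℝ | u ∈ Set.Ioo (0 : ℝ) 1 ∧ bAssessor γl γr p u < y}) ∧
      MeasureTheory.volume (J p m) = ENNReal.ofReal m) :
    ∀ tlo : ℝ, 0 < tlo → ∀ ε : ℝ, 0 < ε →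
      ∃ δ > (0 : ℝ), ∀ p ∈ K, ∀ pstar ∈ K, ‖p - pstar‖ < δ →
        ∀ t : ℝ, tlo ≤ t →
          (ε < (MeasureTheory.volume
              {u : ℝ | u ∈ Set.Ioo (0 : ℝ) 1 ∧ bAssessor γl γr pstar u < 1 / t}).toReal →
            J pstar ((MeasureTheory.volume
              {u : ℝ | u ∈ Set.Ioo (0 : ℝ) 1 ∧ bAssessor γl γr pstar u < 1 / t}).toReal - ε)
              ⊆ {u : ℝ | u ∈ Set.Ioo (0 : ℝ) 1 ∧ bAssessor γl γr p u < 1 / t}) ∧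
          ((MeasureTheory.volume
              {u : ℝ | u ∈ Set.Ioo (0 : ℝ) 1 ∧ bAssessor γl γr pstar u < 1 / t}).toReal + ε < 1 →
            {u : ℝ | u ∈ Set.Ioo (0 : ℝ) 1 ∧ bAssessor γl γr p u < 1 / t}
              ⊆ J pstar ((MeasureTheory.volume
                {u : ℝ | u ∈ Set.Ioo (0 : ℝ) 1 ∧ bAssessor γl γr pstar u < 1 / t}).toReal + ε)) := by
  intro tlo htlo ε hε
  obtain ⟨η, hη, hband⟩ :=
    ((eventually_volume_band_lt hγl.le hγr.le hK hKsub (1 / tlo) hε).filter_mono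
      nhdsWithin_le_nhds |>.and (self_mem_nhdsWithin (s := Ioi (0 : ℝ)))).exists.imp
      fun _ h => h.symm
  have hη : 0 < η := hη
  obtain ⟨δ, hδ, hcont⟩ := exists_sublevel_bAssessor_subset (by linarith : 0 < γl)
    (by linarith : 0 < γr) hK hKsub (1 / tlo) hη
  refine ⟨δ, hδ, fun p hp q hq hpq t ht => ?_⟩
  have hy : 1 / t ∈ Icc 0 (1 / tlo) :=
    ⟨one_div_nonneg.2 (htlo.le.trans ht), one_div_le_one_div_of_le htlo ht⟩
  set y := 1 / t
  have hfin : ∀ {s : Set ℝ}, s ⊆ Ioo 0 1 → volume s ≠ ⊤ := fun hs =>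
    ((measure_mono hs).trans_lt measure_Ioo_lt_top).ne
  set M := {u : ℝ | u ∈ Ioo (0 : ℝ) 1 ∧ bAssessor γl γr q u < y}
  set T := {u : ℝ | u ∈ Ioo (0 : ℝ) 1 ∧ |bAssessor γl γr q u - y| ≤ η}
  have hM : volume M ≠ ⊤ := hfin fun u hu => hu.1
  have hT : volume T < ENNReal.ofReal ε := hband q hq y hy
  have hM1 : (volume M).toReal ≤ 1 := by
    have hsub : M ⊆ Ioo 0 1 := fun u hu => hu.1
    have := ENNReal.toReal_mono measure_Ioo_lt_top.ne (measure_mono (μ := volume) hsub)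
    simpa using this
  have hM0 : 0 ≤ (volume M).toReal := ENNReal.toReal_nonneg
  have hMeq : volume M = ENNReal.ofReal (volume M).toReal := (ENNReal.ofReal_toReal hM).symm
  constructor
  · intro hlt u huJ
    obtain ⟨⟨y', hJy⟩, hJm⟩ := hJ q hq ((volume M).toReal - ε) ⟨by linarith, by linarith⟩
    rw [hJy] at huJ
    have hy' : y' ≤ y - η := by
      by_contra! hgt
      have hsub : M ⊆ J q ((volume M).toReal - ε) ∪ T := by
        rw [hJy]
        intro v hv
        by_cases h : bAssessor γl γr q v < y'
        · exact Or.inl ⟨hv.1, h⟩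
        · exact Or.inr ⟨hv.1, abs_le.2 ⟨by linarith, by linarith [hv.2]⟩⟩
      refine absurd ((measure_mono (μ := volume) hsub).trans (measure_union_le _ _)) (not_le.2 ?_)
      rw [hJm]
      calc _ < ENNReal.ofReal ((volume M).toReal - ε) + ENNReal.ofReal ε :=
            ENNReal.add_lt_add_left ENNReal.ofReal_ne_top hT
        _ = volume M := by
            rw [← ENNReal.ofReal_add (by linarith) hε.le, sub_add_cancel, ← hMeq]
    have h := hcont q hq p hp (by rwa [norm_sub_rev]) (y - η) (by linarith [hy.2]) u huJ.1
      (huJ.2.trans_le hy')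
    exact ⟨huJ.1, by linarith⟩
  · intro hlt u hu
    obtain ⟨⟨y', hJy⟩, hJm⟩ := hJ q hq ((volume M).toReal + ε) ⟨by linarith, hlt⟩
    have hy' : y + η ≤ y' := by
      by_contra! hgt
      have hsub : J q ((volume M).toReal + ε) ⊆ M ∪ T := by
        rw [hJy]
        intro v hv
        by_cases h : bAssessor γl γr q v < y
        · exact Or.inl ⟨hv.1, h⟩
        · exact Or.inr ⟨hv.1, abs_le.2 ⟨by linarith, by linarith [hv.2]⟩⟩
      refine absurd ((measure_mono (μ := volume) hsub).trans (measure_union_le _ _)) (not_le.2 ?_)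
      rw [hJm, ENNReal.ofReal_add hM0 hε.le, ← hMeq]
      exact ENNReal.add_lt_add_left hM hT
    rw [hJy]
    exact ⟨hu.1, (hcont p hp q hq hpq y hy.2 u hu.1 hu.2).trans_le hy'⟩
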